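/- There is a function f such that every graph admitting a vertex order with no (k+1)-twist has stack number at most f(k), and moreover f(k) = Ω(k log k): there exist vertex orders with no (k+1)-twist that require at least c·k·log k stacks for some constant c > 0 and infinitely many k. -/

import Mathlib

/-- The vertex set of a directed edge set. -/
def verts (E : Finset (ℕ × ℕ)) : Finset ℕ := E.image Prod.fst ∪ E.image Prod.snd

/-- Two directed edges cross with respect to a vertex order `f`
(the order places vertex `v` at position `f v`). -/
def Crosses (f : ℕ → ℕ) (e e' : ℕ × ℕ) : Prop :=
  (f e.1 < f e'.1 ∧ f e'.1 < f e.2 ∧ f e.2 < f e'.2) ∨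
  (f e'.1 < f e.1 ∧ f e.1 < f e'.2 ∧ f e'.2 < f e.2)

/-- `f` is (an injective position function representing) a linear extension of `E`. -/
def LinExt (E : Finset (ℕ × ℕ)) (f : ℕ → ℕ) : Prop :=
  Function.Injective f ∧ ∀ e ∈ E, f e.1 < f e.2

/-- The edges `(s i, t i)` form a `k`-twist under `f`:
`s 0 < … < s (k-1) < t 0 < … < t (k-1)`. -/
def IsTwist (E : Finset (ℕ × ℕ)) (f : ℕ → ℕ) (k : ℕ) (s t : Fin k → ℕ) : Prop :=
  (∀ i, (s i, t i) ∈ E) ∧ StrictMono (f ∘ s) ∧ StrictMono (f ∘ t) ∧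
    ∀ i j, f (s i) < f (t j)

/-- The maximum twist size of `E` under `f` is at most `k`. -/
def TwistLE (E : Finset (ℕ × ℕ)) (f : ℕ → ℕ) (k : ℕ) : Prop :=
  ∀ m, ∀ s t : Fin m → ℕ, IsTwist E f m s t → m ≤ k

/-- `c` assigns edges to stacks: edges in the same stack never cross. -/
def ValidStacks (E : Finset (ℕ × ℕ)) (f : ℕ → ℕ) (c : ℕ × ℕ → ℕ) : Prop :=
  ∀ e ∈ E, ∀ e' ∈ E, c e = c e' → ¬ Crosses f e e'

/-- `E` admits a `k`-stack layout: a linear extension together with a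
partition of the edges into `k` stacks of pairwise non-crossing edges. -/
def HasStackLayout (E : Finset (ℕ × ℕ)) (k : ℕ) : Prop :=
  ∃ f c, LinExt E f ∧ (∀ e ∈ E, c e < k) ∧ ValidStacks E f c

/-- The interval `e` is contained in the interval `I`. -/
def SubInterval (e I : ℕ × ℕ) : Prop := I.1 ≤ e.1 ∧ e.2 ≤ I.2

/-- Every set of pairwise crossing intervals of `E` has at most `k` elements. -/
def CliqueLE (E : Finset (ℕ × ℕ)) (k : ℕ) : Prop :=
  ∀ K ⊆ E, (∀ e ∈ K, ∀ e' ∈ K, e ≠ e' → Crosses id e e') → K.card ≤ k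

/-- The intervals of `E` can be partitioned into `n` stacks. -/
def StackColorable (E : Finset (ℕ × ℕ)) (n : ℕ) : Prop :=
  ∃ c : ℕ × ℕ → ℕ, (∀ e ∈ E, c e < n) ∧ ValidStacks E id c

theorem crosses_id {e e' : ℕ × ℕ} : Crosses id e e' ↔
    (e.1 < e'.1 ∧ e'.1 < e.2 ∧ e.2 < e'.2) ∨ (e'.1 < e.1 ∧ e.1 < e'.2 ∧ e'.2 < e.2) := Iff.rfl

theorem CliqueLE.mono {E E' : Finset (ℕ × ℕ)} {k : ℕ} (h : CliqueLE E k) (hE : E' ⊆ E) :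
    CliqueLE E' k :=
  fun K hK hc => h K (hK.trans hE) hc

theorem StackColorable.mono {E : Finset (ℕ × ℕ)} {n n' : ℕ} (h : StackColorable E n)
    (hn : n ≤ n') : StackColorable E n' := by
  obtain ⟨c, hc, hv⟩ := h
  exact ⟨c, fun e he => (hc e he).trans_le hn, hv⟩

/-- Colour the fibres of a labelling separately and combine them with a colouring that
separates crossing intervals with different labels. -/
theorem StackColorable.of_label {ι : Type*} {E : Finset (ℕ × ℕ)} {q n : ℕ} (lab : ℕ × ℕ → ι)
    (g : ℕ × ℕ → ℕ) (hg : ∀ e ∈ E, g e < q)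
    (hlab : ∀ e ∈ E, ∀ e' ∈ E, Crosses id e e' → g e = g e' → lab e = lab e')
    (hfib : ∀ i, ∀ T ⊆ E, (∀ e ∈ T, lab e = i) → StackColorable T n) :
    StackColorable E (q * n) := by
  classical
  have key : ∀ i, StackColorable (E.filter fun e => lab e = i) n := fun i =>
    hfib i _ (Finset.filter_subset _ _) fun e he => (Finset.mem_filter.1 he).2
  choose c hc hv using key
  have hcl : ∀ e ∈ E, c (lab e) e < n := fun e he =>
    hc _ _ (Finset.mem_filter.2 ⟨he, rfl⟩)
  refine ⟨fun e => c (lab e) e + g e * n, fun e he => ?_, fun e he e' he' heq hx => ?_⟩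
  · have h1 := hcl e he
    have h2 := hg e he
    calc c (lab e) e + g e * n < g e * n + n := by omega
      _ = (g e + 1) * n := by ring
      _ ≤ q * n := Nat.mul_le_mul_right _ h2
  · have h1 := hcl e he
    have h2 := hcl e' he'
    have hn : 0 < n := by omega
    have hgg : g e = g e' := by
      have := congrArg (· / n) heq
      simpa only [Nat.add_mul_div_right _ _ hn, Nat.div_eq_of_lt h1, Nat.div_eq_of_lt h2,
        Nat.zero_add] using this
    have hl := hlab e he e' he' hx hgg
    have hcc : c (lab e) e = c (lab e) e' := by
      simp only [hgg, ← hl] at heq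
      omega
    exact hv (lab e) e (Finset.mem_filter.2 ⟨he, rfl⟩) e'
      (Finset.mem_filter.2 ⟨he', hl.symm⟩) hcc hx

/-- In a non-crossing set, every edge is the longest one at its left end
or the longest one at its right end. -/
theorem longest_left_or_right {S : Finset (ℕ × ℕ)} (hlt : ∀ e ∈ S, e.1 < e.2)
    (hnc : ∀ e ∈ S, ∀ e' ∈ S, ¬ Crosses id e e') {e : ℕ × ℕ} (he : e ∈ S) :
    (∀ e' ∈ S, e'.1 = e.1 → e'.2 ≤ e.2) ∨ (∀ e' ∈ S, e'.2 = e.2 → e.1 ≤ e'.1) := by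
  by_contra! h
  obtain ⟨⟨x, hx, hx1, hx2⟩, y, hy, hy1, hy2⟩ := h
  have := hlt e he
  exact hnc y hy x hx (crosses_id.2 (Or.inl (by omega)))

theorem exists_two_coloring_of_unique_right (T : Finset (ℕ × ℕ)) :
    (∀ e ∈ T, e.1 < e.2) → (∀ e ∈ T, ∀ e' ∈ T, e.1 = e'.1 → e = e') →
    ∃ h : ℕ → ℕ, (∀ a, h a < 2) ∧ ∀ e ∈ T, h e.1 ≠ h e.2 := by
  classical
  refine Finset.induction_on_min_value Prod.fst T ?_ ?_
  · exact fun _ _ => ⟨fun _ => 0, by simp, by simp⟩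
  · intro e T heT hmin ih hlt hun
    obtain ⟨h, hb, hh⟩ := ih (fun x hx => hlt x (Finset.mem_insert_of_mem hx))
      (fun x hx y hy => hun x (Finset.mem_insert_of_mem hx) y (Finset.mem_insert_of_mem hy))
    refine ⟨Function.update h e.1 (1 - h e.2), fun a => ?_, fun x hx => ?_⟩
    · by_cases ha : a = e.1
      · subst ha; simp
      · simpa [Function.update_of_ne ha] using hb a
    · have he := hlt e (Finset.mem_insert_self _ _)
      rcases Finset.mem_insert.1 hx with rfl | hxT
      · have := hb x.2
        rw [Function.update_self, Function.update_of_ne (by omega)]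
        omega
      · have h1 := hmin x hxT
        have h2 : x.1 ≠ e.1 := fun h => heT
          (hun x hx e (Finset.mem_insert_self _ _) h ▸ hxT)
        have h3 := hlt x hx
        rw [Function.update_of_ne h2, Function.update_of_ne (by omega)]
        exact hh x hxT

theorem exists_two_coloring_of_unique_left (T : Finset (ℕ × ℕ)) :
    (∀ e ∈ T, e.1 < e.2) → (∀ e ∈ T, ∀ e' ∈ T, e.2 = e'.2 → e = e') →
    ∃ h : ℕ → ℕ, (∀ a, h a < 2) ∧ ∀ e ∈ T, h e.1 ≠ h e.2 := by
  classical
  refine Finset.induction_on_max_value Prod.snd T ?_ ?_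
  · exact fun _ _ => ⟨fun _ => 0, by simp, by simp⟩
  · intro e T heT hmax ih hlt hun
    obtain ⟨h, hb, hh⟩ := ih (fun x hx => hlt x (Finset.mem_insert_of_mem hx))
      (fun x hx y hy => hun x (Finset.mem_insert_of_mem hx) y (Finset.mem_insert_of_mem hy))
    refine ⟨Function.update h e.2 (1 - h e.1), fun a => ?_, fun x hx => ?_⟩
    · by_cases ha : a = e.2
      · subst ha; simp
      · simpa [Function.update_of_ne ha] using hb a
    · have he := hlt e (Finset.mem_insert_self _ _)
      rcases Finset.mem_insert.1 hx with rfl | hxT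
      · have := hb x.1
        rw [Function.update_self, Function.update_of_ne (by omega)]
        omega
      · have h1 := hmax x hxT
        have h2 : x.2 ≠ e.2 := fun h => heT
          (hun x hx e (Finset.mem_insert_self _ _) h ▸ hxT)
        have h3 := hlt x hx
        rw [Function.update_of_ne h2, Function.update_of_ne (by omega)]
        exact hh x hxT

/-- The edges of a non-crossing set can be coloured with four colours so that no two edges
of the same colour form a monotone path. -/
theorem exists_four_coloring_of_noncrossing {S : Finset (ℕ × ℕ)} (hlt : ∀ e ∈ S, e.1 < e.2)
    (hnc : ∀ e ∈ S, ∀ e' ∈ S, ¬ Crosses id e e') :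
    ∃ c : ℕ × ℕ → ℕ, (∀ e, c e < 4) ∧ ∀ e ∈ S, ∀ e' ∈ S, e.2 = e'.1 → c e ≠ c e' := by
  classical
  let Q : ℕ × ℕ → Prop := fun e => ∀ e' ∈ S, e'.1 = e.1 → e'.2 ≤ e.2
  obtain ⟨h, hb, hh⟩ := exists_two_coloring_of_unique_right (S.filter Q)
    (fun e he => hlt e (Finset.mem_filter.1 he).1) (by
      intro e he e' he' h
      rw [Finset.mem_filter] at he he'
      have h1 := he.2 e' he'.1 h.symm
      have h2 := he'.2 e he.1 h
      exact Prod.ext h (by omega))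
  obtain ⟨h', hb', hh'⟩ := exists_two_coloring_of_unique_left (S.filter fun e => ¬ Q e)
    (fun e he => hlt e (Finset.mem_filter.1 he).1) (by
      intro e he e' he' h
      rw [Finset.mem_filter] at he he'
      have h1 := ((longest_left_or_right hlt hnc he.1).resolve_left he.2) e' he'.1 h.symm
      have h2 := ((longest_left_or_right hlt hnc he'.1).resolve_left he'.2) e he.1 h
      exact Prod.ext (by omega) h)
  refine ⟨fun e => if Q e then h e.1 else 2 + h' e.1, fun e => ?_, fun e he e' he' hee => ?_⟩
  · have := hb e.1
    have := hb' e.1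
    dsimp only
    split_ifs <;> omega
  · have := hb e.1
    have := hb e'.1
    dsimp only
    split_ifs with h1 h2 h2
    · rw [← hee]; exact hh e (Finset.mem_filter.2 ⟨he, h1⟩)
    · omega
    · omega
    · have := hh' e (Finset.mem_filter.2 ⟨he, h1⟩)
      rw [← hee]; omega

theorem card_filter_le_lt_card_filter_lt {P : Finset ℕ} {l r : ℕ} :
    (P.filter (· ≤ l)).card < (P.filter (· < r)).card ↔ ∃ p ∈ P, l < p ∧ p < r := by
  constructor
  · intro h
    by_contra! hc
    refine absurd (Finset.card_le_card (fun q hq => ?_)) (not_le.2 h)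
    rw [Finset.mem_filter] at hq ⊢
    refine ⟨hq.1, ?_⟩
    by_contra hlq
    have := hc q hq.1 (by omega)
    omega
  · rintro ⟨p, hp, h1, h2⟩
    refine Finset.card_lt_card ⟨fun q hq => ?_, fun hs => ?_⟩
    · rw [Finset.mem_filter] at hq ⊢
      exact ⟨hq.1, by omega⟩
    · have := (Finset.mem_filter.1 (hs (Finset.mem_filter.2 ⟨hp, h2⟩))).2
      omega

/-- If every interval of `U` contains a point of `P`, and those containing a fixed point of `P`
have no `k + 1` pairwise crossing members, then `U` can be coloured. -/
theorem StackColorable.of_stabbed {k n : ℕ}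
    (ih : ∀ E : Finset (ℕ × ℕ), (∀ e ∈ E, e.1 < e.2) → CliqueLE E k → StackColorable E n)
    {U : Finset (ℕ × ℕ)} {P : Finset ℕ} (hlt : ∀ u ∈ U, u.1 < u.2)
    (hP : ∀ u ∈ U, ∃ p ∈ P, u.1 < p ∧ p < u.2)
    (hC : ∀ p ∈ P, CliqueLE (U.filter fun u => u.1 < p ∧ p < u.2) k) :
    StackColorable U (4 * n * n) := by
  classical
  let gap : ℕ × ℕ → ℕ × ℕ := fun u => ((P.filter (· ≤ u.1)).card, (P.filter (· < u.2)).card)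
  have hgap : ∀ u v : ℕ × ℕ, (gap u).1 < (gap v).2 ↔ ∃ p ∈ P, u.1 < p ∧ p < v.2 :=
    fun u v => card_filter_le_lt_card_filter_lt
  have hgap1 : ∀ u v : ℕ × ℕ, (gap u).1 < (gap v).1 → u.1 < v.1 := by
    intro u v h
    by_contra! hc
    refine absurd (Finset.card_le_card (fun q hq => ?_)) (not_le.2 h)
    rw [Finset.mem_filter] at hq ⊢
    exact ⟨hq.1, hq.2.trans hc⟩
  have hgap2 : ∀ u v : ℕ × ℕ, (gap u).2 < (gap v).2 → u.2 < v.2 := by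
    intro u v h
    by_contra! hc
    refine absurd (Finset.card_le_card (fun q hq => ?_)) (not_le.2 h)
    rw [Finset.mem_filter] at hq ⊢
    exact ⟨hq.1, hq.2.trans_le hc⟩
  have hltg : ∀ e ∈ U.image gap, e.1 < e.2 := by
    intro e he
    obtain ⟨u, hu, rfl⟩ := Finset.mem_image.1 he
    exact (hgap u u).2 (hP u hu)
  have hcl : CliqueLE (U.image gap) k := by
    intro K' hK' hc
    have hsec : ∀ e : K', ∃ u ∈ U, gap u = e := fun e => Finset.mem_image.1 (hK' e.2)
    choose σ hσU hσ using hsec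
    have hσinj : Function.Injective σ := fun a b h => Subtype.ext (by rw [← hσ a, ← hσ b, h])
    rcases K'.eq_empty_or_nonempty with rfl | hne
    · simp
    let K := Finset.univ.image σ
    have hKne : K.Nonempty := by
      obtain ⟨a, ha⟩ := hne
      exact ⟨σ ⟨a, ha⟩, Finset.mem_image_of_mem _ (Finset.mem_univ _)⟩
    have hKcard : K.card = K'.card := by
      rw [Finset.card_image_of_injective _ hσinj, Finset.card_univ, Fintype.card_coe]
    have hlt' : ∀ a b : K', (gap (σ a)).1 < (gap (σ b)).2 := by
      intro a b
      have ha := hltg _ (hK' a.2)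
      have hb := hltg _ (hK' b.2)
      rw [hσ, hσ]
      by_cases hab : (a : ℕ × ℕ) = b
      · rw [← hab]; exact ha
      · have := crosses_id.1 (hc a a.2 b b.2 hab)
        omega
    obtain ⟨u, huK, hu⟩ := K.exists_max_image Prod.fst hKne
    obtain ⟨v, hvK, hv⟩ := K.exists_min_image Prod.snd hKne
    obtain ⟨a, -, rfl⟩ := Finset.mem_image.1 huK
    obtain ⟨b, -, rfl⟩ := Finset.mem_image.1 hvK
    obtain ⟨p, hp, hp1, hp2⟩ := (hgap _ _).1 (hlt' a b)
    rw [← hKcard]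
    refine hC p hp K (fun w hw => ?_) ?_
    · have h1 := hu w hw
      have h2 := hv w hw
      obtain ⟨d, -, rfl⟩ := Finset.mem_image.1 hw
      exact Finset.mem_filter.2 ⟨hσU d, by omega, by omega⟩
    · intro w hw x hx hwx
      have h1 := hu w hw
      have h2 := hv w hw
      have h3 := hu x hx
      have h4 := hv x hx
      obtain ⟨d, -, rfl⟩ := Finset.mem_image.1 hw
      obtain ⟨e, -, rfl⟩ := Finset.mem_image.1 hx
      have hde : (d : ℕ × ℕ) ≠ e := fun h => hwx (by rw [Subtype.ext h])
      have hX := crosses_id.1 (hc d d.2 e e.2 hde)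
      rw [← hσ, ← hσ] at hX
      rw [crosses_id]
      rcases hX with ⟨g1, -, g3⟩ | ⟨g1, -, g3⟩
      · have := hgap1 _ _ g1
        have := hgap2 _ _ g3
        exact Or.inl ⟨by assumption, by omega, by assumption⟩
      · have := hgap1 _ _ g1
        have := hgap2 _ _ g3
        exact Or.inr ⟨by assumption, by omega, by assumption⟩
  obtain ⟨c₁, hc₁, hv₁⟩ := ih _ hltg hcl
  have h4 : ∀ i, ∃ c : ℕ × ℕ → ℕ, (∀ e, c e < 4) ∧
      ∀ e ∈ (U.image gap).filter (c₁ · = i), ∀ e' ∈ (U.image gap).filter (c₁ · = i),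
        e.2 = e'.1 → c e ≠ c e' := fun i =>
    exists_four_coloring_of_noncrossing (fun e he => hltg e (Finset.mem_filter.1 he).1)
      (fun e he e' he' => by
        rw [Finset.mem_filter] at he he'
        exact hv₁ e he.1 e' he'.1 (he.2.trans he'.2.symm))
  choose c₂ hc₂ hv₂ using h4
  let g : ℕ × ℕ → ℕ := fun u => c₂ (c₁ (gap u)) (gap u) + 4 * c₁ (gap u)
  refine StackColorable.of_label g g (fun u hu => ?_) (fun _ _ _ _ _ h => h) ?_
  · have h1 := hc₂ (c₁ (gap u)) (gap u)
    have h2 := hc₁ (gap u) (Finset.mem_image_of_mem _ hu)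
    simp only [g]
    omega
  intro i T hTU hT
  refine ih T (fun e he => hlt e (hTU he)) (fun K hK hc => ?_)
  rcases K.eq_empty_or_nonempty with rfl | hne
  · simp
  obtain ⟨u, huK, hu⟩ := K.exists_max_image Prod.fst hne
  obtain ⟨v, hvK, hv⟩ := K.exists_min_image Prod.snd hne
  have huU := hTU (hK huK)
  have hvU := hTU (hK hvK)
  by_cases hp : ∃ p ∈ P, u.1 < p ∧ p < v.2
  · obtain ⟨p, hp, hp1, hp2⟩ := hp
    refine hC p hp K (fun w hw => ?_) hc
    have h1 := hu w hw
    have h2 := hv w hw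
    exact Finset.mem_filter.2 ⟨hTU (hK hw), by omega, by omega⟩
  · exfalso
    have huv : u ≠ v := by
      rintro rfl
      exact hp (hP u huU)
    have hX := crosses_id.1 (hc u huK v hvK huv)
    have hu1 := hlt u huU
    have hv1 := hlt v hvU
    have hle := not_lt.1 (fun h => hp ((hgap u v).1 h))
    have hge : (gap u).1 ≤ (gap v).2 := by
      refine Finset.card_le_card fun q hq => ?_
      rw [Finset.mem_filter] at hq ⊢
      exact ⟨hq.1, by omega⟩
    have hgg : g u = g v := (hT u (hK huK)).trans (hT v (hK hvK)).symm
    have b1 := hc₂ (c₁ (gap u)) (gap u)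
    have b2 := hc₂ (c₁ (gap v)) (gap v)
    have e1 : c₁ (gap v) = c₁ (gap u) := by simp only [g] at hgg; omega
    have e2 : c₂ (c₁ (gap u)) (gap v) = c₂ (c₁ (gap u)) (gap u) := by
      simp only [g, e1] at hgg; omega
    exact hv₂ (c₁ (gap u)) (gap v)
      (Finset.mem_filter.2 ⟨Finset.mem_image_of_mem _ hvU, e1⟩) (gap u)
      (Finset.mem_filter.2 ⟨Finset.mem_image_of_mem _ huU, rfl⟩) (le_antisymm hle hge) e2

/-- The crossing graph of `E`. -/
def crossingGraph (E : Finset (ℕ × ℕ)) : SimpleGraph (ℕ × ℕ) where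
  Adj e e' := e ∈ E ∧ e' ∈ E ∧ Crosses id e e'
  symm := ⟨fun e e' h => ⟨h.2.1, h.1, by rw [crosses_id]; exact (crosses_id.1 h.2.2).symm⟩⟩
  loopless := ⟨fun e h => by have := crosses_id.1 h.2.2; omega⟩

/-- Breadth-first search layers of the crossing graph, from an inclusion-maximal interval of each
component; `root` picks a component representative and `lev` is the distance to it. -/
theorem exists_layering (E : Finset (ℕ × ℕ)) (hlt : ∀ e ∈ E, e.1 < e.2) :
    ∃ (root : ℕ × ℕ → ℕ × ℕ) (lev : ℕ × ℕ → ℕ),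
      (∀ e ∈ E, ∀ e' ∈ E, Crosses id e e' → root e = root e' ∧ lev e' ≤ lev e + 1) ∧
      (∀ e ∈ E, ∀ n, lev e = n + 1 → ∃ e' ∈ E, Crosses id e' e ∧ lev e' = n) ∧
      (∀ e ∈ E, ∀ e' ∈ E, root e = root e' → lev e = 0 → SubInterval e e' → e' = e) := by
  classical
  let G := crossingGraph E
  have hroot : ∀ C : G.ConnectedComponent, ∃ x : ℕ × ℕ, ∀ e ∈ E, G.connectedComponentMk e = C →
      x ∈ E ∧ G.connectedComponentMk x = C ∧ e.2 - e.1 ≤ x.2 - x.1 := by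
    intro C
    rcases (E.filter fun e => G.connectedComponentMk e = C).eq_empty_or_nonempty with h | h
    · refine ⟨0, fun e he hC => ?_⟩
      have : e ∈ E.filter fun e => G.connectedComponentMk e = C := Finset.mem_filter.2 ⟨he, hC⟩
      simp [h] at this
    · obtain ⟨x, hx, hmax⟩ := Finset.exists_max_image _ (fun e => e.2 - e.1) h
      rw [Finset.mem_filter] at hx
      exact ⟨x, fun e he hC => ⟨hx.1, hx.2, hmax e (Finset.mem_filter.2 ⟨he, hC⟩)⟩⟩
  choose rt hrt using hroot
  let root : ℕ × ℕ → ℕ × ℕ := fun e => rt (G.connectedComponentMk e)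
  have hreach : ∀ e ∈ E, G.Reachable (root e) e := fun e he =>
    SimpleGraph.ConnectedComponent.exact (hrt _ e he rfl).2.1
  refine ⟨root, fun e => G.dist (root e) e, fun e he e' he' hx => ?_, fun e he n hn => ?_,
    fun e he e' he' hr h0 hs => ?_⟩
  · have hadj : G.Adj e e' := ⟨he, he', hx⟩
    have hr : root e = root e' := by
      simp only [root, SimpleGraph.ConnectedComponent.connectedComponentMk_eq_of_adj hadj]
    refine ⟨hr, ?_⟩
    have := hadj.diff_dist_adj (u := root e)
    dsimp only
    rw [← hr]
    omega
  · have hpar : ∀ x, ∀ w : G.Walk e x, w.length = G.dist x e → G.dist x e = n + 1 →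
        ∃ v, G.Adj e v ∧ G.dist x v = n := by
      intro x w hw hn
      cases w with
      | nil => simp at hn
      | cons hadj p =>
        have h1 := SimpleGraph.dist_le p
        rw [SimpleGraph.dist_comm] at h1
        rw [SimpleGraph.Walk.length_cons] at hw
        have h2 := hadj.diff_dist_adj (u := x)
        exact ⟨_, hadj, by omega⟩
    obtain ⟨w, hw⟩ := (hreach e he).symm.exists_walk_length_eq_dist
    rw [SimpleGraph.dist_comm] at hw
    obtain ⟨v, hadj, hv⟩ := hpar _ w hw hn
    have hr : root e = root v := by
      simp only [root, SimpleGraph.ConnectedComponent.connectedComponentMk_eq_of_adj hadj]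
    exact ⟨v, hadj.2.1, hadj.symm.2.2, by rwa [hr] at hv⟩
  · have hre : root e = e := (hreach e he).dist_eq_zero_iff.1 h0
    have h1 := (hreach e he)
    rw [hr] at h1
    have hC : G.connectedComponentMk e' = G.connectedComponentMk e :=
      SimpleGraph.ConnectedComponent.sound ((hreach e' he').symm.trans h1)
    have h2 := (hrt _ e' he' hC).2.2
    change _ ≤ (root e).2 - (root e).1 at h2
    rw [hre] at h2
    have := hlt e he
    have := hlt e' he'
    obtain ⟨h3, h4⟩ := hs
    exact Prod.ext (by omega) (by omega)

/-- An inclusion antichain of intervals without `k + 2` pairwise crossing members can be coloured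
with `k + 1` colours. -/
theorem StackColorable.of_antichain {A : Finset (ℕ × ℕ)} {k : ℕ}
    (hanti : ∀ e ∈ A, ∀ e' ∈ A, SubInterval e e' → e' = e) (hk : CliqueLE A (k + 1)) :
    StackColorable A (k + 1) := by
  classical
  let rk : ℕ × ℕ → ℕ := fun e => (A.filter fun x => x.1 < e.1).card
  have key : ∀ e ∈ A, ∀ e' ∈ A, e.1 < e'.1 → e'.1 < e.2 → rk e % (k + 1) ≠ rk e' % (k + 1) := by
    intro e he e' he' h1 h2 hmod
    let K := A.filter fun x => e.1 ≤ x.1 ∧ x.1 ≤ e'.1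
    have hsplit : rk e' = rk e + (A.filter fun x => e.1 ≤ x.1 ∧ x.1 < e'.1).card := by
      rw [← Finset.card_union_of_disjoint]
      · refine congrArg Finset.card (Finset.ext fun x => ?_)
        simp only [Finset.mem_union, Finset.mem_filter]
        grind
      · rw [Finset.disjoint_filter]
        intro x _ hx
        omega
    have hne : 0 < (A.filter fun x => e.1 ≤ x.1 ∧ x.1 < e'.1).card :=
      Finset.card_pos.2 ⟨e, Finset.mem_filter.2 ⟨he, le_rfl, h1⟩⟩
    have hdvd : k + 1 ∣ (A.filter fun x => e.1 ≤ x.1 ∧ x.1 < e'.1).card := by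
      have := (Nat.modEq_iff_dvd' (by omega : rk e ≤ rk e')).1 hmod
      rwa [hsplit, Nat.add_sub_cancel_left] at this
    have hge := Nat.le_of_dvd hne hdvd
    have hlt : (A.filter fun x => e.1 ≤ x.1 ∧ x.1 < e'.1).card < K.card := by
      refine Finset.card_lt_card ⟨fun x hx => ?_, fun hs => ?_⟩
      · rw [Finset.mem_filter] at hx ⊢
        exact ⟨hx.1, hx.2.1, hx.2.2.le⟩
      · have := hs (Finset.mem_filter.2 ⟨he', h1.le, le_rfl⟩)
        rw [Finset.mem_filter] at this
        omega
    have := hk K (Finset.filter_subset _ _) (by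
      intro x hx y hy hxy
      rw [Finset.mem_filter] at hx hy
      have a1 := hanti x hx.1 y hy.1
      have a2 := hanti y hy.1 x hx.1
      have a3 := hanti e he x hx.1
      have a4 := hanti e he y hy.1
      have a5 := hanti x hx.1 e he
      have a6 := hanti y hy.1 e he
      simp only [SubInterval] at a1 a2 a3 a4 a5 a6
      have hx2 : e.2 ≤ x.2 := by
        by_contra! h
        have := a5 ⟨hx.2.1, h.le⟩
        subst this
        omega
      have hy2 : e.2 ≤ y.2 := by
        by_contra! h
        have := a6 ⟨hy.2.1, h.le⟩
        subst this
        omega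
      have n1 : ¬ (y.1 ≤ x.1 ∧ x.2 ≤ y.2) := fun h => hxy (a1 h).symm
      have n2 : ¬ (x.1 ≤ y.1 ∧ y.2 ≤ x.2) := fun h => hxy (a2 h)
      rw [crosses_id]
      omega)
    omega
  refine ⟨fun e => rk e % (k + 1), fun e _ => Nat.mod_lt _ (Nat.succ_pos _), ?_⟩
  intro e he e' he' hmod hx
  rcases crosses_id.1 hx with h | h
  · exact key e he e' he' h.1 h.2.1 hmod
  · exact key e' he' e he h.1 h.2.1 hmod.symm

/-- If every interval of `U` lies in `I` and is crossed by some interval of `E` that also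
crosses `I`, then `U` can be coloured. -/
theorem StackColorable.of_crossed {k n : ℕ}
    (ih : ∀ E : Finset (ℕ × ℕ), (∀ e ∈ E, e.1 < e.2) → CliqueLE E k → StackColorable E n)
    {E U : Finset (ℕ × ℕ)} {I : ℕ × ℕ} (hlt : ∀ e ∈ E, e.1 < e.2) (hE : CliqueLE E (k + 1))
    (hUE : U ⊆ E) (hI : ∀ u ∈ U, SubInterval u I)
    (hp : ∀ u ∈ U, u ≠ I → ∃ p ∈ E, Crosses id p u ∧ Crosses id p I) :
    StackColorable U (3 * (4 * n * n + 1)) := by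
  classical
  have hins : ∀ (K : Finset (ℕ × ℕ)) (p : ℕ × ℕ), K ⊆ E → p ∈ E →
      (∀ e ∈ K, ∀ e' ∈ K, e ≠ e' → Crosses id e e') → (∀ e ∈ K, Crosses id p e) →
      K.card ≤ k := by
    intro K p hK hpE hc hpc
    have hpK : p ∉ K := fun h => by have := crosses_id.1 (hpc p h); omega
    have := hE (insert p K) (Finset.insert_subset hpE hK) (by
      intro e he e' he' hne
      rcases Finset.mem_insert.1 he with he | he <;>
        rcases Finset.mem_insert.1 he' with he' | he'
      · exact absurd (he.trans he'.symm) hne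
      · exact he ▸ hpc _ he'
      · exact he' ▸ crosses_id.2 (crosses_id.1 (hpc _ he)).symm
      · exact hc e he e' he' hne)
    rw [Finset.card_insert_of_notMem hpK] at this
    omega
  let R : ℕ × ℕ → Prop := fun u => ∃ p ∈ E, u.1 < p.1 ∧ p.1 < u.2 ∧ I.2 < p.2
  let g : ℕ × ℕ → ℕ := fun u => if u = I then 0 else if R u then 1 else 2
  refine StackColorable.of_label g g (fun u _ => by simp only [g]; split_ifs <;> omega)
    (fun _ _ _ _ _ h => h) ?_
  intro i T hTU hT
  have hTE := hTU.trans hUE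
  by_cases h0 : i = 0
  · refine ⟨fun _ => 0, fun _ _ => Nat.succ_pos _, fun e he e' he' _ hx => ?_⟩
    have hI' : ∀ u ∈ T, u = I := by
      intro u hu
      have := hT u hu
      simp only [g, h0] at this
      by_contra h
      rw [if_neg h] at this
      split_ifs at this
    rw [hI' e he, hI' e' he', crosses_id] at hx
    omega
  by_cases h1 : i = 1
  · have hR : ∀ u ∈ T, R u := by
      intro u hu
      have := hT u hu
      simp only [g, h1] at this
      split_ifs at this
      · assumption
      · omega
    refine (StackColorable.of_stabbed ih
      (P := (E.filter fun p => I.2 < p.2).image Prod.fst) (fun u hu => hlt u (hTE hu))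
      (fun u hu => ?_) (fun q hq K hK hc => ?_)).mono (Nat.le_succ _)
    · obtain ⟨p, hpE, h2, h3, h4⟩ := hR u hu
      exact ⟨p.1, Finset.mem_image_of_mem _ (Finset.mem_filter.2 ⟨hpE, h4⟩), h2, h3⟩
    · obtain ⟨p, hpE, rfl⟩ := Finset.mem_image.1 hq
      rw [Finset.mem_filter] at hpE
      refine hins K p (hK.trans ((Finset.filter_subset _ _).trans hTE)) hpE.1 hc fun e he => ?_
      have h2 := Finset.mem_filter.1 (hK he)
      have h3 := (hI e (hTU h2.1)).2
      exact crosses_id.2 (Or.inr (by omega))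
  · have hL : ∀ u ∈ T, ∃ p ∈ E, u.1 < p.2 ∧ p.2 < u.2 ∧ p.1 < I.1 := by
      intro u hu
      have hg := hT u hu
      have huI : u ≠ I := by
        rintro rfl
        simp only [g, if_true] at hg
        exact h0 hg.symm
      have hnR : ¬ R u := by
        intro hR
        simp only [g, if_neg huI, if_pos hR] at hg
        exact h1 hg.symm
      obtain ⟨p, hpE, hx1, hx2⟩ := hp u (hTU hu) huI
      have hs := hI u (hTU hu)
      rw [crosses_id] at hx1 hx2
      obtain ⟨hs1, hs2⟩ := hs
      refine ⟨p, hpE, ?_⟩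
      by_contra hcon
      exact hnR ⟨p, hpE, by omega⟩
    refine (StackColorable.of_stabbed ih
      (P := (E.filter fun p => p.1 < I.1).image Prod.snd) (fun u hu => hlt u (hTE hu))
      (fun u hu => ?_) (fun q hq K hK hc => ?_)).mono (Nat.le_succ _)
    · obtain ⟨p, hpE, h2, h3, h4⟩ := hL u hu
      exact ⟨p.2, Finset.mem_image_of_mem _ (Finset.mem_filter.2 ⟨hpE, h4⟩), h2, h3⟩
    · obtain ⟨p, hpE, rfl⟩ := Finset.mem_image.1 hq
      rw [Finset.mem_filter] at hpE
      refine hins K p (hK.trans ((Finset.filter_subset _ _).trans hTE)) hpE.1 hc fun e he => ?_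
      have h2 := Finset.mem_filter.1 (hK he)
      have h3 := (hI e (hTU h2.1)).1
      exact crosses_id.2 (Or.inl (by omega))

/-- A number of stacks sufficient for every order without `k + 1` pairwise crossing edges. -/
def stackBound : ℕ → ℕ
  | 0 => 0
  | k + 1 => 2 * ((k + 1) * (3 * (4 * stackBound k * stackBound k + 1)))

theorem CliqueLE.stackColorable (k : ℕ) : ∀ E : Finset (ℕ × ℕ), (∀ e ∈ E, e.1 < e.2) →
    CliqueLE E k → StackColorable E (stackBound k) := by
  classical
  induction k with
  | zero =>
    intro E _ hE
    have hemp : ∀ e, e ∉ E := fun e he => by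
      have := hE {e} (Finset.singleton_subset_iff.2 he) (by
        intro x hx y hy hxy
        rw [Finset.mem_singleton] at hx hy
        exact absurd (hx.trans hy.symm) hxy)
      simp at this
    exact ⟨fun _ => 0, fun e he => absurd he (hemp e), fun e he => absurd he (hemp e)⟩
  | succ k ih =>
    intro E hlt hE
    obtain ⟨root, lev, hadj, hpar, hzero⟩ := exists_layering E hlt
    have hmono : ∀ n, ∀ p ∈ E, ∀ I ∈ E, root p = root I → SubInterval p I → lev p = n →
        lev I ≤ n := by
      intro n
      induction n with
      | zero =>
        intro p hp I hI hr hs hn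
        rw [hzero p hp I hI hr hn hs]
        exact hn.le
      | succ n ihn =>
        intro p hp I hI hr hs hn
        obtain ⟨q, hq, hx, hqn⟩ := hpar p hp n hn
        by_cases hqI : Crosses id q I
        · have := (hadj q hq I hI hqI).2
          omega
        · have h1 := ihn q hq I hI ((hadj q hq p hp hx).1.trans hr) (by
            obtain ⟨hs1, hs2⟩ := hs
            rw [crosses_id] at hx hqI
            constructor <;> omega) hqn
          omega
    refine StackColorable.of_label (fun e => (root e, lev e)) (fun e => lev e % 2)
      (fun e _ => Nat.mod_lt _ two_pos) (fun e he e' he' hx hg => ?_) ?_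
    · have h1 := hadj e he e' he' hx
      have h2 := hadj e' he' e he (crosses_id.2 (crosses_id.1 hx).symm)
      exact Prod.ext h1.1 (by dsimp only at hg ⊢; omega)
    rintro ⟨C, d⟩ L hLE hL
    have hLroot : ∀ e ∈ L, root e = C := fun e he => congrArg Prod.fst (hL e he)
    have hLlev : ∀ e ∈ L, lev e = d := fun e he => congrArg Prod.snd (hL e he)
    have houter : ∀ u, ∃ I, u ∈ L → I ∈ L ∧ SubInterval u I ∧
        ∀ J ∈ L, SubInterval I J → J = I := by
      intro u
      by_cases hu : u ∈ L
      · obtain ⟨I, hI, hmax⟩ := Finset.exists_max_image (L.filter fun J => SubInterval u J)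
          (fun J => J.2 - J.1) ⟨u, Finset.mem_filter.2 ⟨hu, le_rfl, le_rfl⟩⟩
        rw [Finset.mem_filter] at hI
        refine ⟨I, fun _ => ⟨hI.1, hI.2, fun J hJ hs => ?_⟩⟩
        have h1 := hmax J (Finset.mem_filter.2
          ⟨hJ, hs.1.trans hI.2.1, hI.2.2.trans hs.2⟩)
        have h2 := hlt I (hLE hI.1)
        have h3 := hlt J (hLE hJ)
        obtain ⟨h4, h5⟩ := hs
        exact Prod.ext (by omega) (by omega)
      · exact ⟨u, fun h => absurd h hu⟩
    choose outer ho using houter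
    let A := L.filter fun I => ∀ J ∈ L, SubInterval I J → J = I
    have hAL : A ⊆ L := Finset.filter_subset _ _
    have hoA : ∀ u ∈ L, outer u ∈ A := fun u hu =>
      Finset.mem_filter.2 ⟨(ho u hu).1, (ho u hu).2.2⟩
    obtain ⟨c, hc, hv⟩ := StackColorable.of_antichain (A := A) (k := k)
      (fun e he e' he' => (Finset.mem_filter.1 he).2 e' (hAL he'))
      (hE.mono (hAL.trans hLE))
    refine StackColorable.of_label outer (fun u => c (outer u)) (fun u hu => hc _ (hoA u hu))
      (fun u hu v hv' hx hg => ?_) ?_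
    · by_contra hne
      have h1 := hv _ (hoA u hu) _ (hoA v hv') hg
      have n1 := (ho u hu).2.2 _ (ho v hv').1
      have n2 := (ho v hv').2.2 _ (ho u hu).1
      have n3 : ¬ SubInterval (outer u) (outer v) := fun h => hne (n1 h).symm
      have n4 : ¬ SubInterval (outer v) (outer u) := fun h => hne (n2 h)
      obtain ⟨s1, s2⟩ := (ho u hu).2.1
      obtain ⟨s3, s4⟩ := (ho v hv').2.1
      simp only [SubInterval] at n3 n4
      rw [crosses_id] at h1 hx
      omega
    · intro I T hTL hT
      refine StackColorable.of_crossed ih hlt hE (I := I) (hTL.trans hLE)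
        (fun u hu => hT u hu ▸ (ho u (hTL hu)).2.1) (fun u hu huI => ?_)
      have huL := hTL hu
      have hIL : I ∈ L := hT u hu ▸ (ho u huL).1
      have hsub : SubInterval u I := hT u hu ▸ (ho u huL).2.1
      rcases Nat.eq_zero_or_pos d with hd | hd
      · exact absurd (hzero u (hLE huL) I (hLE hIL) ((hLroot u huL).trans (hLroot I hIL).symm)
          ((hLlev u huL).trans hd) hsub).symm huI
      · obtain ⟨p, hpE, hx, hpl⟩ := hpar u (hLE huL) (d - 1) (by rw [hLlev u huL]; omega)
        refine ⟨p, hpE, hx, ?_⟩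
        by_contra hpI
        have := hmono (d - 1) p hpE I (hLE hIL)
          ((hadj p hpE u (hLE huL) hx).1.trans ((hLroot u huL).trans (hLroot I hIL).symm)) (by
            obtain ⟨hs1, hs2⟩ := hsub
            rw [crosses_id] at hx hpI
            constructor <;> omega) hpl
        rw [hLlev I hIL] at this
        omega

theorem TwistLE.cliqueLE_image {E : Finset (ℕ × ℕ)} {f : ℕ → ℕ} {k : ℕ} (hf : LinExt E f)
    (h : TwistLE E f k) : CliqueLE (E.image fun e => (f e.1, f e.2)) k := by
  classical
  intro K hK hc
  have hlt : ∀ e ∈ K, e.1 < e.2 := by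
    intro e he
    obtain ⟨x, hx, rfl⟩ := Finset.mem_image.1 (hK he)
    exact hf.2 x hx
  have hinj : Set.InjOn Prod.fst (K : Set (ℕ × ℕ)) := by
    intro e he e' he' hee
    by_contra hne
    have := crosses_id.1 (hc e he e' he' hne)
    omega
  have hcard := Finset.card_image_of_injOn hinj
  let o := (K.image Prod.fst).orderEmbOfFin hcard
  have hex : ∀ i, ∃ x ∈ E, (f x.1, f x.2) ∈ K ∧ f x.1 = o i := by
    intro i
    obtain ⟨e, he, heo⟩ := Finset.mem_image.1 (Finset.orderEmbOfFin_mem _ hcard i)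
    obtain ⟨x, hx, rfl⟩ := Finset.mem_image.1 (hK he)
    exact ⟨x, hx, he, heo⟩
  choose x hxE hxK hxo using hex
  have hmono : ∀ i j, i < j → f (x i).1 < f (x j).1 ∧ f (x j).1 < f (x i).2 ∧
      f (x i).2 < f (x j).2 := by
    intro i j hij
    have h1 : f (x i).1 < f (x j).1 := by
      rw [hxo, hxo]
      exact o.strictMono hij
    have := crosses_id.1 (hc _ (hxK i) _ (hxK j) (fun h => h1.ne (congrArg Prod.fst h)))
    dsimp only at this
    omega
  refine h K.card (fun i => (x i).1) (fun i => (x i).2) ⟨hxE, fun i j hij => (hmono i j hij).1,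
    fun i j hij => (hmono i j hij).2.2, fun i j => ?_⟩
  have hi := hlt _ (hxK i)
  have hj := hlt _ (hxK j)
  rcases lt_trichotomy i j with hij | rfl | hij
  · exact (hmono i j hij).1.trans hj
  · exact hi
  · exact (hmono j i hij).2.1

theorem TwistLE.exists_validStacks {E : Finset (ℕ × ℕ)} {f : ℕ → ℕ} {k : ℕ} (hf : LinExt E f)
    (h : TwistLE E f k) :
    ∃ c : ℕ × ℕ → ℕ, (∀ e ∈ E, c e < stackBound k) ∧ ValidStacks E f c := by
  classical
  obtain ⟨c, hc, hv⟩ := CliqueLE.stackColorable k (E.image fun e => (f e.1, f e.2))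
    (fun e he => by
      obtain ⟨x, hx, rfl⟩ := Finset.mem_image.1 he
      exact hf.2 x hx) (h.cliqueLE_image hf)
  exact ⟨fun e => c (f e.1, f e.2), fun e he => hc _ (Finset.mem_image_of_mem _ he),
    fun e he e' he' hee => hv _ (Finset.mem_image_of_mem _ he) _
      (Finset.mem_image_of_mem _ he') hee⟩

theorem card_le_of_pairwise_crossing {S : Finset (ℕ × ℕ)} (hlt : ∀ e ∈ S, e.1 < e.2)
    (hc : ∀ e ∈ S, ∀ e' ∈ S, e ≠ e' → Crosses id e e') {g : ℕ × ℕ} (hg : g ∈ S) :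
    S.card ≤ g.2 - g.1 := by
  classical
  rw [← Nat.card_Ioc]
  refine Finset.card_le_card_of_injOn (fun e => if g.1 < e.1 then e.1 else e.2)
    (fun e he => ?_) (fun e he e' he' hee => ?_)
  · have h1 := hlt e he
    rw [Finset.coe_Ioc, Set.mem_Ioc]
    by_cases heg : e = g
    · subst heg
      simpa using h1
    · have := crosses_id.1 (hc e he g hg heg)
      dsimp only
      split_ifs <;> omega
  · by_contra hne
    have h1 := hlt e he
    have h2 := hlt e' he'
    have h3 := crosses_id.1 (hc e he e' he' hne)
    dsimp only at hee
    split_ifs at hee <;> omega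

theorem card_le_of_noncrossing {S : Finset (ℕ × ℕ)} {n : ℕ} (hlt : ∀ e ∈ S, e.1 < e.2)
    (hn : ∀ e ∈ S, e.2 < n) (hnc : ∀ e ∈ S, ∀ e' ∈ S, ¬ Crosses id e e') :
    S.card ≤ 2 * n := by
  classical
  let Q : ℕ × ℕ → Prop := fun e => ∀ e' ∈ S, e'.1 = e.1 → e'.2 ≤ e.2
  have h1 : (S.filter Q).card ≤ n := by
    rw [← Finset.card_range n]
    refine Finset.card_le_card_of_injOn Prod.fst (fun e he => ?_) (fun e he e' he' h => ?_)
    · rw [Finset.mem_coe, Finset.mem_filter] at he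
      rw [Finset.coe_range, Set.mem_Iio]
      exact (hlt e he.1).trans (hn e he.1)
    · rw [Finset.mem_coe, Finset.mem_filter] at he he'
      have h1 := he.2 e' he'.1 h.symm
      have h2 := he'.2 e he.1 h
      exact Prod.ext h (by omega)
  have h2 : (S.filter fun e => ¬ Q e).card ≤ n := by
    rw [← Finset.card_range n]
    refine Finset.card_le_card_of_injOn Prod.snd (fun e he => ?_) (fun e he e' he' h => ?_)
    · rw [Finset.mem_coe, Finset.mem_filter] at he
      rw [Finset.coe_range, Set.mem_Iio]
      exact hn e he.1
    · rw [Finset.mem_coe, Finset.mem_filter] at he he'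
      have h1 := ((longest_left_or_right hlt hnc he.1).resolve_left he.2) e' he'.1 h.symm
      have h2 := ((longest_left_or_right hlt hnc he'.1).resolve_left he'.2) e he.1 h
      exact Prod.ext (by omega) h
  have := Finset.card_filter_add_card_filter_not (s := S) Q
  omega

/-- The position of the `c`-th copy in the `b`-th group of endpoints at the place `a`. -/
def blowupPos (B a b c : ℕ) : ℕ := (a * B + b) * B + c

theorem mul_add_lt_mul_add_iff {B a a' x x' : ℕ} (hx : x < B) (hx' : x' < B) :
    a * B + x < a' * B + x' ↔ a < a' ∨ a = a' ∧ x < x' := by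
  rcases lt_trichotomy a a' with h | rfl | h
  · have : (a + 1) * B ≤ a' * B := Nat.mul_le_mul_right _ h
    simp only [h, true_or, iff_true]
    linarith
  · simp
  · have : (a' + 1) * B ≤ a * B := Nat.mul_le_mul_right _ h
    simp only [h.not_gt, h.ne', false_and, or_false, iff_false]
    linarith

theorem blowupPos_lt_iff {B a b c a' b' c' : ℕ} (hb : b < B) (hb' : b' < B) (hc : c < B)
    (hc' : c' < B) :
    blowupPos B a b c < blowupPos B a' b' c' ↔ a < a' ∨ a = a' ∧ (b < b' ∨ b = b' ∧ c < c') := by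
  have h1 := mul_add_lt_mul_add_iff (a := a) (a' := a') hb hb'
  have h2 := mul_add_lt_mul_add_iff (a := a') (a' := a) hb' hb
  unfold blowupPos
  rw [mul_add_lt_mul_add_iff hc hc', h1]
  omega

/-- The chords `⟨(i, l), r⟩`: the `r`-th copy of the chord from `i` to `i + l`; there are
`k / l` copies of each chord of length `l`. -/
def chords (k : ℕ) : Finset (Σ _ : ℕ × ℕ, ℕ) :=
  (Finset.range k ×ˢ Finset.Icc 1 k).sigma fun g => Finset.range (k / g.2)

/-- The ends of a chord before the vertices are blown up. -/
def chordEnds (x : Σ _ : ℕ × ℕ, ℕ) : ℕ × ℕ := (x.1.1, x.1.1 + x.1.2)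

/-- The interval representing a chord: copies of the same chord cross each other, while
distinct chords with a common end do not cross. -/
def chordInterval (k : ℕ) (x : Σ _ : ℕ × ℕ, ℕ) : ℕ × ℕ :=
  (blowupPos (2 * k + 1) (2 * x.1.1 + 1) (2 * k - (x.1.1 + x.1.2)) x.2,
    blowupPos (2 * k + 1) (2 * (x.1.1 + x.1.2)) (2 * k - x.1.1) x.2)

theorem mem_chords {k : ℕ} {x : Σ _ : ℕ × ℕ, ℕ} :
    x ∈ chords k ↔ (x.1.1 < k ∧ 1 ≤ x.1.2 ∧ x.1.2 ≤ k) ∧ x.2 < k / x.1.2 := by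
  simp [chords]

theorem crosses_chordInterval_iff {k : ℕ} {x y : Σ _ : ℕ × ℕ, ℕ} (hx : x ∈ chords k)
    (hy : y ∈ chords k) : Crosses id (chordInterval k x) (chordInterval k y) ↔
      Crosses id (chordEnds x) (chordEnds y) ∨ chordEnds x = chordEnds y ∧ x.2 ≠ y.2 := by
  rw [mem_chords] at hx hy
  have h1 := Nat.div_le_self k x.1.2
  have h2 := Nat.div_le_self k y.1.2
  have h3 : x.2 < k := by omega
  have h4 : y.2 < k := by omega
  simp only [crosses_id, chordInterval, chordEnds, Prod.mk.injEq]
  rw [blowupPos_lt_iff, blowupPos_lt_iff, blowupPos_lt_iff, blowupPos_lt_iff, blowupPos_lt_iff,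
    blowupPos_lt_iff] <;> omega

theorem chordInterval_lt {k : ℕ} {x : Σ _ : ℕ × ℕ, ℕ} (hx : x ∈ chords k) :
    (chordInterval k x).1 < (chordInterval k x).2 := by
  rw [mem_chords] at hx
  have h1 := Nat.div_le_self k x.1.2
  have h3 : x.2 < k := by omega
  simp only [chordInterval]
  rw [blowupPos_lt_iff] <;> omega

theorem chord_ext {x y : Σ _ : ℕ × ℕ, ℕ} (h : chordEnds x = chordEnds y) (h2 : x.2 = y.2) :
    x = y := by
  obtain ⟨⟨i, l⟩, r⟩ := x
  obtain ⟨⟨i', l'⟩, r'⟩ := y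
  simp only [chordEnds, Prod.mk.injEq] at h
  dsimp only at h2
  obtain ⟨rfl, h⟩ := h
  obtain rfl : l = l' := by omega
  rw [h2]

theorem chordEnds_lt {k : ℕ} {x : Σ _ : ℕ × ℕ, ℕ} (hx : x ∈ chords k) :
    (chordEnds x).1 < (chordEnds x).2 ∧ (chordEnds x).2 < 2 * k := by
  rw [mem_chords] at hx
  simp only [chordEnds]
  omega

theorem card_chords (k : ℕ) : (chords k).card = k * ∑ l ∈ Finset.Icc 1 k, k / l := by
  simp [chords, Finset.card_sigma, Finset.sum_product]

theorem card_le_of_crossing_chords {k : ℕ} {X : Finset (Σ _ : ℕ × ℕ, ℕ)} (hX : X ⊆ chords k)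
    (hc : ∀ x ∈ X, ∀ y ∈ X, x ≠ y →
      Crosses id (chordInterval k x) (chordInterval k y)) : X.card ≤ k := by
  classical
  have hS : ∀ g ∈ X.image chordEnds, (X.image chordEnds).card ≤ g.2 - g.1 := fun g hg =>
    card_le_of_pairwise_crossing (by
      intro e he
      obtain ⟨x, hx, rfl⟩ := Finset.mem_image.1 he
      exact (chordEnds_lt (hX hx)).1) (by
      intro e he e' he' hne
      obtain ⟨x, hx, rfl⟩ := Finset.mem_image.1 he
      obtain ⟨y, hy, rfl⟩ := Finset.mem_image.1 he'
      exact ((crosses_chordInterval_iff (hX hx) (hX hy)).1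
        (hc x hx y hy fun h => hne (congrArg _ h))).resolve_right fun h => hne h.1) hg
  calc X.card ≤ k / (X.image chordEnds).card * (X.image chordEnds).card := by
        refine Finset.card_le_mul_card_image _ _ fun g hg => ?_
        have hpos : 0 < (X.image chordEnds).card := Finset.card_pos.2 ⟨g, hg⟩
        refine le_trans ?_ (Nat.div_le_div_left (hS g hg) hpos)
        rw [← Finset.card_range (k / (g.2 - g.1))]
        refine Finset.card_le_card_of_injOn (fun x => x.2) (fun x hx => ?_)
          (fun x hx y hy h => ?_)
        · rw [Finset.mem_coe, Finset.mem_filter] at hx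
          have h1 := (mem_chords.1 (hX hx.1)).2
          have h2 : g.2 - g.1 = x.1.2 := by
            rw [← hx.2]
            simp [chordEnds]
          rw [h2]
          simpa using h1
        · rw [Finset.mem_coe, Finset.mem_filter] at hx hy
          exact chord_ext (hx.2.trans hy.2.symm) h
    _ ≤ k := Nat.div_mul_le_self _ _

theorem twistLE_chords (k : ℕ) : TwistLE ((chords k).image (chordInterval k)) id k := by
  classical
  rintro m s t ⟨hE, hs, ht, hst⟩
  choose x hx hxe using fun i => Finset.mem_image.1 (hE i)
  have hxs : ∀ i, (chordInterval k (x i)).1 = s i := fun i => by rw [hxe]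
  have hinj : Function.Injective x := fun i j h =>
    hs.injective (by simp only [Function.comp_apply, id, ← hxs, h])
  rw [← Fintype.card_fin m, ← Finset.card_univ, ← Finset.card_image_of_injective _ hinj]
  refine card_le_of_crossing_chords (fun y hy => ?_) (fun y hy z hz hyz => ?_)
  · obtain ⟨i, -, rfl⟩ := Finset.mem_image.1 hy
    exact hx i
  · obtain ⟨i, -, rfl⟩ := Finset.mem_image.1 hy
    obtain ⟨j, -, rfl⟩ := Finset.mem_image.1 hz
    rw [hxe, hxe]
    rcases lt_or_gt_of_ne (fun h : i = j => hyz (congrArg x h)) with hij | hij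
    · exact Or.inl ⟨hs hij, hst j i, ht hij⟩
    · exact Or.inr ⟨hs hij, hst i j, ht hij⟩

theorem card_chords_le_of_validStacks {k j : ℕ} {col : ℕ × ℕ → ℕ}
    (hcol : ∀ e ∈ (chords k).image (chordInterval k), col e < j)
    (hv : ValidStacks ((chords k).image (chordInterval k)) id col) :
    (chords k).card ≤ 2 * (2 * k) * j := by
  classical
  have hmem : ∀ x ∈ chords k, chordInterval k x ∈ (chords k).image (chordInterval k) :=
    fun x hx => Finset.mem_image_of_mem _ hx
  have key := Finset.card_le_mul_card_image_of_maps_to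
    (s := chords k) (t := Finset.range j) (f := fun x => col (chordInterval k x))
    (fun x hx => Finset.mem_range.2 (hcol _ (hmem x hx))) (2 * (2 * k)) ?_
  · rwa [Finset.card_range] at key
  intro b _
  let T := (chords k).filter fun x => col (chordInterval k x) = b
  have hnc : ∀ x ∈ T, ∀ y ∈ T, ¬ Crosses id (chordInterval k x) (chordInterval k y) := by
    intro x hx y hy
    rw [Finset.mem_filter] at hx hy
    exact hv _ (hmem x hx.1) _ (hmem y hy.1) (hx.2.trans hy.2.symm)
  have hT : ∀ x ∈ T, x ∈ chords k := fun x hx => (Finset.mem_filter.1 hx).1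
  have hinj : Set.InjOn chordEnds (T : Set (Σ _ : ℕ × ℕ, ℕ)) := by
    intro x hx y hy h
    by_contra hne
    exact hnc x hx y hy ((crosses_chordInterval_iff (hT x hx) (hT y hy)).2
      (Or.inr ⟨h, fun h2 => hne (chord_ext h h2)⟩))
  change T.card ≤ _
  rw [← Finset.card_image_of_injOn hinj]
  refine card_le_of_noncrossing (fun e he => ?_) (fun e he => ?_) (fun e he e' he' h => ?_)
  · obtain ⟨x, hx, rfl⟩ := Finset.mem_image.1 he
    exact (chordEnds_lt (hT x hx)).1
  · obtain ⟨x, hx, rfl⟩ := Finset.mem_image.1 he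
    exact (chordEnds_lt (hT x hx)).2
  · obtain ⟨x, hx, rfl⟩ := Finset.mem_image.1 he
    obtain ⟨y, hy, rfl⟩ := Finset.mem_image.1 he'
    exact hnc x hx y hy ((crosses_chordInterval_iff (hT x hx) (hT y hy)).2 (Or.inl h))

theorem mul_log_le_sum_div {k : ℕ} (hk : 0 < k) :
    (k : ℝ) * Real.log k ≤ 2 * ((∑ l ∈ Finset.Icc 1 k, k / l : ℕ) : ℝ) := by
  have hk' : (0 : ℝ) < k := Nat.cast_pos.2 hk
  have h1 : Real.log k ≤ ∑ l ∈ Finset.Icc 1 k, (l : ℝ)⁻¹ := by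
    have h := log_add_one_le_harmonic k
    rw [harmonic_eq_sum_Icc] at h
    push_cast at h
    exact (Real.log_le_log hk' (by linarith)).trans h
  calc (k : ℝ) * Real.log k ≤ k * ∑ l ∈ Finset.Icc 1 k, (l : ℝ)⁻¹ := by gcongr
    _ = ∑ l ∈ Finset.Icc 1 k, (k : ℝ) * (l : ℝ)⁻¹ := Finset.mul_sum _ _ _
    _ ≤ ∑ l ∈ Finset.Icc 1 k, 2 * ((k / l : ℕ) : ℝ) := by
        refine Finset.sum_le_sum fun l hl => ?_
        rw [Finset.mem_Icc] at hl
        have hl0 : (0 : ℝ) < l := Nat.cast_pos.2 hl.1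
        rw [← div_eq_mul_inv, div_le_iff₀ hl0]
        have h2 : 1 ≤ k / l := (Nat.one_le_div_iff hl.1).2 hl.2
        have h3 : k < l * (k / l + 1) := Nat.lt_mul_div_succ k hl.1
        have h4 : k ≤ 2 * (k / l) * l := by nlinarith
        exact_mod_cast h4
    _ = 2 * ((∑ l ∈ Finset.Icc 1 k, k / l : ℕ) : ℝ) := by
        push_cast
        rw [Finset.mul_sum]

/-- There is a function `F` bounding the stack number of every graph admitting
a vertex order with no `(k+1)`-twist by `F k`; moreover `F k = Ω(k * log k)`:
for some `c > 0` and infinitely many `k` there are vertex orders with no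
`(k+1)`-twist requiring at least `c * k * log k` stacks. -/
theorem bounded_twist_stack_number_bounds :
    ∃ F : ℕ → ℕ,
      (∀ (E : Finset (ℕ × ℕ)) (f : ℕ → ℕ) (k : ℕ), LinExt E f → TwistLE E f k →
        ∃ c : ℕ × ℕ → ℕ, (∀ e ∈ E, c e < F k) ∧ ValidStacks E f c) ∧
      (∃ c : ℝ, 0 < c ∧ ∀ N : ℕ, ∃ k ≥ N, ∃ (E : Finset (ℕ × ℕ)) (f : ℕ → ℕ),
        LinExt E f ∧ TwistLE E f k ∧
        ∀ (col : ℕ × ℕ → ℕ) (j : ℕ), (∀ e ∈ E, col e < j) →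
          ValidStacks E f col → c * k * Real.log k ≤ (j : ℝ)) := by
  classical
  refine ⟨stackBound, fun E f k hf h => h.exists_validStacks hf, 1 / 8, by norm_num, fun N =>
    ⟨N + 1, N.le_succ, (chords (N + 1)).image (chordInterval (N + 1)), id,
      ⟨Function.injective_id, fun e he => ?_⟩, twistLE_chords _, fun col j hcol hv => ?_⟩⟩
  · obtain ⟨x, hx, rfl⟩ := Finset.mem_image.1 he
    exact chordInterval_lt hx
  · have h1 := card_chords_le_of_validStacks hcol hv
    rw [card_chords] at h1
    have h2 : ∑ l ∈ Finset.Icc 1 (N + 1), (N + 1) / l ≤ 4 * j :=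
      Nat.le_of_mul_le_mul_left (by linarith) N.succ_pos
    have h3 := mul_log_le_sum_div N.succ_pos
    have h4 : ((∑ l ∈ Finset.Icc 1 (N + 1), (N + 1) / l : ℕ) : ℝ) ≤ 4 * j := by
      exact_mod_cast h2
    simp only [Nat.succ_eq_add_one] at h3
    linarith
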